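/- (Spin-1 projection, case w_0 = 0.) Let F = 1 and 0 < M < 1, and let w = (w_1, 0, w_{−1}) ∈ ℝ^N with w_1 ≠ 0 and w_{−1} ≠ 0. Define z_0 = 0 and z_l = (√(1 + lM)/(√2·‖w_l‖))·w_l for l = ±1. Then z ∈ 𝓜 and z minimizes ‖y − w‖ over all y ∈ 𝓜. -/

import Mathlib

open scoped RealInnerProductSpace

/-- The positive multiple of `w` with squared norm `a / 2`. -/
lemma norm_sqrt_div_smul_sq {E : Type*} [NormedAddCommGroup E] [NormedSpace ℝ E]
    {w : E} (hw : w ≠ 0) {a : ℝ} (ha : 0 ≤ a) :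
    ‖(Real.sqrt a / (Real.sqrt 2 * ‖w‖)) • w‖ ^ 2 = a / 2 := by
  have hw' : ‖w‖ ≠ 0 := norm_ne_zero_iff.mpr hw
  rw [norm_smul, mul_pow, Real.norm_eq_abs, sq_abs, div_pow, mul_pow, Real.sq_sqrt ha,
    Real.sq_sqrt zero_le_two]
  field_simp

/-- Among vectors in a ball centred at the origin, a nonnegative multiple of `w` on the
boundary sphere maximizes the inner product with `w`. -/
lemma real_inner_le_real_inner_smul {E : Type*} [NormedAddCommGroup E] [InnerProductSpace ℝ E]
    (w y : E) {c : ℝ} (hc : 0 ≤ c) (hy : ‖y‖ ^ 2 ≤ ‖c • w‖ ^ 2) :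
    ⟪y, w⟫ ≤ ⟪c • w, w⟫ := by
  have h : ‖y‖ ≤ ‖c • w‖ := le_of_sq_le_sq hy (norm_nonneg _)
  calc ⟪y, w⟫ ≤ ‖y‖ * ‖w‖ := real_inner_le_norm y w
    _ ≤ ‖c • w‖ * ‖w‖ := by gcongr
    _ = ⟪c • w, w⟫ := by
      rw [norm_smul, Real.norm_of_nonneg hc, real_inner_smul_left,
        real_inner_self_eq_norm_mul_norm, mul_assoc]

/-- A sum over `{-1, 0, 1}`, written out. -/
lemma sum_Icc_neg_one_one {A : Type*} [AddCommMonoid A] (f : ℤ → A) :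
    ∑ l ∈ Finset.Icc (-1 : ℤ) 1, f l = f (-1) + (f 0 + f 1) := by
  have h : Finset.Icc (-1 : ℤ) 1 = {-1, 0, 1} := by decide
  simp [h]

/-- spin-1 projection, case `w₀ = 0`: for `0 < M < 1` and
`w = (w₁, 0, w₋₁)` with `w₁ ≠ 0` and `w₋₁ ≠ 0`, define `z₀ = 0` and
`z_l = (√(1+lM)/(√2·‖w_l‖))·w_l` for `l = ±1`.  Then `z ∈ 𝓜` and
`‖z − w‖ ≤ ‖y − w‖` for every `y ∈ 𝓜`. -/
theorem spin1_projection_w0_eq_zero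
    (n : ℕ) (hn : 1 ≤ n) (M : ℝ) (hM0 : 0 < M) (hM1 : M < 1)
    (w : ℤ → EuclideanSpace ℝ (Fin (2 * n)))
    (hsupp : ∀ l : ℤ, l ∉ Finset.Icc (-1 : ℤ) (1 : ℤ) → w l = 0)
    (hw0 : w 0 = 0) (hw1 : w 1 ≠ 0) (hwm1 : w (-1) ≠ 0)
    (z : ℤ → EuclideanSpace ℝ (Fin (2 * n)))
    (hz0 : z 0 = 0)
    (hz1 : z 1 = (Real.sqrt (1 + M) / (Real.sqrt 2 * ‖w 1‖)) • w 1)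
    (hzm1 : z (-1) = (Real.sqrt (1 - M) / (Real.sqrt 2 * ‖w (-1)‖)) • w (-1))
    (hzsupp : ∀ l : ℤ, l ∉ Finset.Icc (-1 : ℤ) (1 : ℤ) → z l = 0) :
    (∑ l ∈ Finset.Icc (-1 : ℤ) (1 : ℤ), ‖z l‖ ^ 2 = 1) ∧
    (∑ l ∈ Finset.Icc (-1 : ℤ) (1 : ℤ), (l : ℝ) * ‖z l‖ ^ 2 = M) ∧
    (∀ y : ℤ → EuclideanSpace ℝ (Fin (2 * n)),
      (∀ l : ℤ, l ∉ Finset.Icc (-1 : ℤ) (1 : ℤ) → y l = 0) →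
      (∑ l ∈ Finset.Icc (-1 : ℤ) (1 : ℤ), ‖y l‖ ^ 2 = 1) →
      (∑ l ∈ Finset.Icc (-1 : ℤ) (1 : ℤ), (l : ℝ) * ‖y l‖ ^ 2 = M) →
      Real.sqrt (∑ l ∈ Finset.Icc (-1 : ℤ) (1 : ℤ), ‖z l - w l‖ ^ 2)
        ≤ Real.sqrt (∑ l ∈ Finset.Icc (-1 : ℤ) (1 : ℤ), ‖y l - w l‖ ^ 2)) := by
  have h1 : ‖z 1‖ ^ 2 = (1 + M) / 2 := hz1 ▸ norm_sqrt_div_smul_sq hw1 (by linarith)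
  have hm1 : ‖z (-1)‖ ^ 2 = (1 - M) / 2 := hzm1 ▸ norm_sqrt_div_smul_sq hwm1 (by linarith)
  simp only [sum_Icc_neg_one_one, Int.cast_neg, Int.cast_one, Int.cast_zero]
  refine ⟨?_, ?_, fun y _ hy hyM => Real.sqrt_le_sqrt ?_⟩
  · rw [h1, hm1, hz0, norm_zero]
    ring
  · rw [h1, hm1]
    ring
  · have hi1 : ⟪y 1, w 1⟫ ≤ ⟪z 1, w 1⟫ := by
      rw [hz1]
      refine real_inner_le_real_inner_smul _ _ (by positivity) ?_
      rw [← hz1, h1]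
      nlinarith [sq_nonneg ‖y 0‖]
    have him1 : ⟪y (-1), w (-1)⟫ ≤ ⟪z (-1), w (-1)⟫ := by
      rw [hzm1]
      refine real_inner_le_real_inner_smul _ _ (by positivity) ?_
      rw [← hzm1, hm1]
      nlinarith [sq_nonneg ‖y 0‖]
    simp only [norm_sub_sq_real, hw0, hz0, inner_zero_right, norm_zero, h1, hm1]
    linarith
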